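/- Let C be an essentially small triangulated category with shift operator Σ, and let ξ : Iso(C) → ℤ be a weak triangle function on C, i.e., a function on isomorphism classes of objects satisfying: (1) ξ(X) ≥ 0 for all X; (2) ξ(0) = 0; (3) ξ(X ⊕ Y) = ξ(X) + ξ(Y) for all X, Y; (4) ξ(ΣX) = ξ(X) for all X; (5) for every distinguished triangle X → Y → Z → ΣX one has ξ(Z) ≤ ξ(X) + ξ(Y). Then ker ξ = { X : ξ(X) = 0 } is a thick subcategory of C (i.e., a full triangulated subcategory closed under isomorphisms, shifts, cones, and direct summands). -/

import Mathlib

open CategoryTheory CategoryTheory.Limits CategoryTheory.Pretriangulated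

universe v u

/-- **Lemma 2.2.** Let `C` be an essentially small (pre)triangulated category and let
`ξ` be a weak triangle function on `C` (a non-negative, additive, shift- and
iso-invariant, subadditive-on-triangles integer function on objects). Then
`ker ξ = {X | ξ X = 0}` is a thick subcategory of `C`: it is closed under isomorphisms,
shifts (in both directions), cones of morphisms between its objects, and direct summands. -/
theorem ker_thick (C : Type u) [Category.{v} C] [Preadditive C] [HasZeroObject C]
    [HasShift C ℤ] [∀ n : ℤ, (shiftFunctor C n).Additive] [Pretriangulated C]
    [HasBinaryBiproducts C] [EssentiallySmall.{v} C]
    (ξ : C → ℤ)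
    (hiso : ∀ {X Y : C}, (X ≅ Y) → ξ X = ξ Y)
    (h1 : ∀ X : C, 0 ≤ ξ X)
    (h2 : ∀ X : C, IsZero X → ξ X = 0)
    (h3 : ∀ X Y : C, ξ (X ⊞ Y) = ξ X + ξ Y)
    (h4 : ∀ X : C, ξ (X⟦(1 : ℤ)⟧) = ξ X)
    (h5 : ∀ T : Triangle C, T ∈ (distTriang C) → ξ T.obj₃ ≤ ξ T.obj₁ + ξ T.obj₂) :
    (∀ X Y : C, (X ≅ Y) → ξ X = 0 → ξ Y = 0) ∧
    (∀ X : C, ξ X = 0 → ξ (X⟦(1 : ℤ)⟧) = 0 ∧ ξ (X⟦(-1 : ℤ)⟧) = 0) ∧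
    (∀ T : Triangle C, T ∈ (distTriang C) → ξ T.obj₁ = 0 → ξ T.obj₂ = 0 → ξ T.obj₃ = 0) ∧
    (∀ X Y : C, ξ (X ⊞ Y) = 0 → ξ X = 0 ∧ ξ Y = 0) := by
  refine ⟨fun X Y e h => (hiso e).symm.trans h, fun X h => ⟨(h4 X).trans h, ?_⟩,
    fun T hT ha hb => ?_, fun X Y h => ?_⟩
  · have e : (X⟦(-1 : ℤ)⟧)⟦(1 : ℤ)⟧ ≅ X :=
      (shiftFunctorCompIsoId C (-1 : ℤ) 1 (by norm_num)).app X
    have ha := h4 (X⟦(-1 : ℤ)⟧)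
    have hb := hiso e
    omega
  · have hc := h5 T hT
    have hd := h1 T.obj₃
    omega
  · have ha := h3 X Y
    have hb := h1 X
    have hc := h1 Y
    omega
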